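/- The Omega constant Ω, defined by Ω * exp(Ω) = 1, is transcendental over ℚ. -/

import Mathlib

open Polynomial

lemma lw_denom {K : Type*} [Field K] [NumberField K] (t : Finset K) :
    ∃ a : ℤ, a ≠ 0 ∧ ∀ x ∈ t, IsIntegral ℤ ((a : K) * x) := by
  classical
  induction t using Finset.induction_on with
  | empty => exact ⟨1, one_ne_zero, by simp⟩
  | insert x t hx ih =>
    obtain ⟨a, ha, hat⟩ := ih
    have hx : IsAlgebraic ℤ x :=
      (IsFractionRing.isAlgebraic_iff ℤ ℚ K).2 (Algebra.IsAlgebraic.isAlgebraic x)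
    obtain ⟨b, hb, hbx⟩ := hx.exists_integral_multiple
    have hbx' : IsIntegral ℤ ((b : K) * x) := by simpa using hbx
    refine ⟨a * b, mul_ne_zero ha hb, ?_⟩
    intro y hy
    rcases Finset.mem_insert.1 hy with rfl | hy
    · have := (isIntegral_intCast (R := ℤ) (B := K) a).mul hbx'
      simpa [mul_assoc] using this
    · have := (isIntegral_intCast (R := ℤ) (B := K) b).mul (hat y hy)
      have e : ((a * b : ℤ) : K) * y = (b : K) * ((a : K) * y) := by
        push_cast; ring
      rw [e]; exact this

lemma lw_int_eval {K : Type*} [Field K] (a : ℤ) (x : K) (hx : IsIntegral ℤ ((a : K) * x))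
    (g : ℤ[X]) (N : ℕ) (hg : g.natDegree ≤ N) : IsIntegral ℤ ((a : K) ^ N * aeval x g) := by
  rw [aeval_eq_sum_range' (Nat.lt_succ_of_le hg), Finset.mul_sum]
  refine IsIntegral.sum _ fun i hi => ?_
  have hi : i ≤ N := by simpa [Nat.lt_succ_iff] using hi
  have : (a : K) ^ N * (g.coeff i • x ^ i) = (g.coeff i : K) * ((a : K) ^ (N - i) * (a * x) ^ i) := by
    obtain ⟨k, rfl⟩ := Nat.exists_eq_add_of_le hi
    simp [pow_add, mul_pow]; ring
  rw [this]
  exact (isIntegral_intCast _).mul (((isIntegral_intCast _).pow _).mul (hx.pow _))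

lemma lw_poly {K : Type*} [Field K] [NumberField K] (s : Finset K) (h0 : (0 : K) ∉ s) :
    ∃ f : ℤ[X], f.eval 0 ≠ 0 ∧ ∀ x ∈ s, aeval x f = 0 := by
  have key : ∀ x : K, x ≠ 0 → ∃ f : ℤ[X], f.eval 0 ≠ 0 ∧ aeval x f = 0 := by
    intro x hx0
    have hx : IsAlgebraic ℤ x :=
      (IsFractionRing.isAlgebraic_iff ℤ ℚ K).2 (Algebra.IsAlgebraic.isAlgebraic x)
    obtain ⟨f, h1, h2⟩ := hx.exists_nonzero_coeff_and_aeval_eq_zero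
      (mem_nonZeroDivisors_of_ne_zero hx0)
    exact ⟨f, by rwa [← coeff_zero_eq_eval_zero], h2⟩
  choose! F hF using key
  refine ⟨∏ x ∈ s, F x, ?_, fun x hx => ?_⟩
  · rw [eval_prod]
    exact Finset.prod_ne_zero_iff.2 fun x hx => (hF x (fun h => h0 (h ▸ hx))).1
  · rw [map_prod]
    exact Finset.prod_eq_zero hx (hF x (fun h => h0 (h ▸ hx))).2

lemma lw_fixed_int {K : Type*} [Field K] [NumberField K] [IsGalois ℚ K] (x : K)
    (hx : IsIntegral ℤ x) (hσ : ∀ σ : K ≃ₐ[ℚ] K, σ x = x) : ∃ m : ℤ, (m : K) = x := by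
  have := (IsGalois.mem_bot_iff_fixed (F := ℚ) x).2 hσ
  obtain ⟨q, rfl⟩ := IntermediateField.mem_bot.1 this
  have hq : IsIntegral ℤ q := (isIntegral_algebraMap_iff (algebraMap ℚ K).injective).1 hx
  obtain ⟨m, rfl⟩ := IsIntegrallyClosed.isIntegral_iff.1 hq
  exact ⟨m, by simp⟩

lemma lw_small (A B C : ℝ) (M : ℕ) :
    ∃ p : ℕ, M < p ∧ p.Prime ∧ B * (A ^ p * (C ^ p / (p - 1).factorial)) < 1 := by
  have h := (FloorSemiring.tendsto_pow_div_factorial_atTop (A * C)).const_mul (B * (A * C))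
  rw [mul_zero] at h
  have h' := h.eventually (gt_mem_nhds (zero_lt_one' ℝ))
  obtain ⟨N, hN⟩ := Filter.eventually_atTop.1 h'
  obtain ⟨p, hp, pp⟩ := Nat.exists_infinite_primes (N + M + 1)
  refine ⟨p, by omega, pp, ?_⟩
  have := hN (p - 1) (by omega)
  obtain ⟨k, rfl⟩ : ∃ k, p = k + 1 := ⟨p - 1, by omega⟩
  refine lt_of_eq_of_lt ?_ this
  simp [pow_succ, mul_pow]; ring

lemma lw_final {K : Type*} [Field K] [NumberField K] [IsGalois ℚ K] (φ : K →+* ℂ)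
    (s : Finset K) (h : K → K) (h0s : (0 : K) ∉ s)
    (hs : ∀ σ : K ≃ₐ[ℚ] K, ∀ x ∈ s, σ x ∈ s)
    (hh : ∀ (σ : K ≃ₐ[ℚ] K) x, h (σ x) = σ (h x)) (h0 : h 0 ≠ 0)
    (hev : φ (h 0) + ∑ x ∈ s, φ (h x) * Complex.exp (φ x) = 0) : False := by
  classical
  obtain ⟨f, hf0, hf⟩ := lw_poly s h0s
  obtain ⟨c, hc⟩ := LindemannWeierstrass.exp_polynomial_approx f hf0
  obtain ⟨a, ha, hat⟩ := lw_denom (insert (h 0) (s ∪ s.image h))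
  obtain ⟨m, hm⟩ := lw_fixed_int ((a : K) * h 0) (hat _ (by simp)) fun σ => by
    rw [map_mul, map_intCast, ← hh, map_zero]
  have hm0 : m ≠ 0 := by
    rintro rfl
    have : (a : K) ≠ 0 := by exact_mod_cast ha
    simp [this, h0] at hm
  set S : ℝ := ∑ x ∈ s, ‖φ (h x)‖ with hS
  set d := f.natDegree with hd
  obtain ⟨p, hpM, pp, hsmall⟩ := lw_small (|(a : ℝ)| ^ d) (|(a : ℝ)| * S) c
    ((eval 0 f).natAbs + a.natAbs + m.natAbs)
  obtain ⟨n, hn, g, hg, hgr⟩ := hc p (by omega) pp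
  have hroot : ∀ x ∈ s, φ x ∈ f.aroots ℂ := by
    intro x hx
    rw [mem_aroots]
    refine ⟨fun hf => hf0 (by simp [hf]), ?_⟩
    have := congrArg φ (hf x hx)
    rw [map_zero] at this
    rw [← this]
    exact aeval_algHom_apply φ.toIntAlgHom x f
  set V : K := ∑ x ∈ s, h x * aeval x g with hV
  have hVfix : ∀ σ : K ≃ₐ[ℚ] K, σ V = V := by
    intro σ
    rw [hV, map_sum]
    refine Finset.sum_bij (fun x _ => σ x) (fun x hx => hs σ x hx)
      (fun x _ y _ hxy => σ.injective hxy)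
      (fun y hy => ⟨σ.symm y, hs σ.symm y hy, by simp⟩) ?_
    intro x hx
    rw [map_mul, hh]
    congr 1
    exact (aeval_algHom_apply ((σ : K →ₐ[ℚ] K).restrictScalars ℤ) x g).symm
  have hVint : IsIntegral ℤ ((a : K) ^ (1 + d * p) * V) := by
    rw [hV, Finset.mul_sum]
    refine IsIntegral.sum _ fun x hx => ?_
    have h1 := hat (h x) (by simp; exact Or.inr (Or.inr ⟨x, hx, rfl⟩))
    have h2 := lw_int_eval a x (hat x (by simp [hx])) g (d * p)
      (hg.trans (by rw [mul_comm]; omega))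
    convert h1.mul h2 using 1
    ring
  obtain ⟨k, hk⟩ := lw_fixed_int _ hVint fun σ => by
    rw [map_mul, map_pow, map_intCast, hVfix]
  have hVφ : φ V = ∑ x ∈ s, φ (h x) * aeval (φ x) g := by
    rw [hV, map_sum]
    refine Finset.sum_congr rfl fun x _ => ?_
    rw [map_mul]
    congr 1
    exact (aeval_algHom_apply φ.toIntAlgHom x g).symm
  have hint : ((a ^ (d * p) * m * n + p * k : ℤ) : ℂ) =
      - ((a : ℂ) ^ (1 + d * p) *
        ∑ x ∈ s, φ (h x) * (n • Complex.exp (φ x) - p • aeval (φ x) g)) := by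
    have e1 : (m : ℂ) = a * φ (h 0) := by
      rw [← map_intCast φ m, hm]; simp
    have e2 : (k : ℂ) = a ^ (1 + d * p) * φ V := by
      rw [← map_intCast φ k, hk]; simp
    have e3 : ∑ x ∈ s, φ (h x) * (n • Complex.exp (φ x) - p • aeval (φ x) g)
        = n * (∑ x ∈ s, φ (h x) * Complex.exp (φ x)) - p * φ V := by
      rw [hVφ, Finset.mul_sum, Finset.mul_sum, ← Finset.sum_sub_distrib]
      refine Finset.sum_congr rfl fun x _ => ?_
      simp; ring
    rw [e3, eq_neg_of_add_eq_zero_right hev]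
    push_cast
    rw [e1, e2]
    ring
  have hlt : ‖((a ^ (d * p) * m * n + p * k : ℤ) : ℂ)‖ < 1 := by
    rw [hint, norm_neg, norm_mul, norm_pow, Complex.norm_intCast]
    refine lt_of_le_of_lt ?_ hsmall
    have : ‖∑ x ∈ s, φ (h x) * (n • Complex.exp (φ x) - p • aeval (φ x) g)‖ ≤
        S * (c ^ p / (p - 1).factorial) := by
      rw [hS, Finset.sum_mul]
      refine (norm_sum_le _ _).trans (Finset.sum_le_sum fun x hx => ?_)
      rw [norm_mul]
      exact mul_le_mul_of_nonneg_left (hgr (hroot x hx)) (norm_nonneg _)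
    refine (mul_le_mul_of_nonneg_left this (by positivity)).trans (le_of_eq ?_)
    rw [pow_add, pow_mul]; ring
  rw [Complex.norm_intCast] at hlt
  have hz : a ^ (d * p) * m * n + p * k = 0 := by
    rw [← Int.abs_lt_one_iff]; exact_mod_cast hlt
  have hdvd : (p : ℤ) ∣ a ^ (d * p) * m * n :=
    (Int.dvd_add_left (dvd_mul_right _ k)).1 (hz ▸ dvd_zero _)
  have hp' := Nat.prime_iff_prime_int.1 pp
  rcases hp'.dvd_or_dvd hdvd with h1 | h1
  · rcases hp'.dvd_or_dvd h1 with h2 | h2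
    · have := Nat.le_of_dvd (Int.natAbs_pos.2 ha) (Int.natCast_dvd.1 (hp'.dvd_of_dvd_pow h2))
      omega
    · have := Nat.le_of_dvd (Int.natAbs_pos.2 hm0) (Int.natCast_dvd.1 h2)
      omega
  · exact hn h1

/-- The diagonal action of an automorphism on the group algebra `K[K]`. -/
noncomputable def lwAct {K : Type*} [Field K] [Algebra ℚ K] (σ : K ≃ₐ[ℚ] K) :
    AddMonoidAlgebra K K →+* AddMonoidAlgebra K K :=
  (AddMonoidAlgebra.mapRingHom K (σ : K →+* K)).comp
    (AddMonoidAlgebra.mapDomainRingHom K (σ : K →+ K))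

lemma lwAct_single {K : Type*} [Field K] [Algebra ℚ K] (σ : K ≃ₐ[ℚ] K) (x r : K) :
    lwAct σ (AddMonoidAlgebra.single x r) = AddMonoidAlgebra.single (σ x) (σ r) := by
  simp [lwAct]

lemma lwAct_lwAct {K : Type*} [Field K] [Algebra ℚ K] (σ τ : K ≃ₐ[ℚ] K)
    (F : AddMonoidAlgebra K K) : lwAct σ (lwAct τ F) = lwAct (σ * τ) F := by
  have : ((lwAct σ).comp (lwAct τ)).toAddMonoidHom = (lwAct (σ * τ)).toAddMonoidHom := by
    apply AddMonoidAlgebra.addMonoidHom_ext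
    intro m r
    simp [lwAct_single]
  exact DFunLike.congr_fun this F

lemma lwAct_one {K : Type*} [Field K] [Algebra ℚ K]
    (F : AddMonoidAlgebra K K) : lwAct 1 F = F := by
  have : (lwAct (1 : K ≃ₐ[ℚ] K)).toAddMonoidHom = AddMonoidHom.id _ := by
    apply AddMonoidAlgebra.addMonoidHom_ext
    intro m r
    simp [lwAct_single]
  exact DFunLike.congr_fun this F

lemma lwAct_coeff {K : Type*} [Field K] [Algebra ℚ K] (σ : K ≃ₐ[ℚ] K)
    (F : AddMonoidAlgebra K K) (x : K) : (lwAct σ F).coeff (σ x) = σ (F.coeff x) := by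
  have h : (lwAct σ F).coeff = ((F.coeff).mapDomain σ).mapRange σ (map_zero σ) := rfl
  rw [h, Finsupp.mapRange_apply, Finsupp.mapDomain_apply σ.injective]

/-- Evaluation `single x r ↦ φ r * exp (φ x)`. -/
noncomputable def lwEv {K : Type*} [Field K] (φ : K →+* ℂ) : AddMonoidAlgebra K K →+* ℂ :=
  AddMonoidAlgebra.liftNCRingHom φ
    (Complex.expMonoidHom.comp (AddMonoidHom.toMultiplicative φ.toAddMonoidHom))
    (fun _ _ => Commute.all _ _)

lemma lwEv_single {K : Type*} [Field K] (φ : K →+* ℂ) (x r : K) :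
    lwEv φ (AddMonoidAlgebra.single x r) = φ r * Complex.exp (φ x) := by
  simp [lwEv]

lemma lwEv_eq {K : Type*} [Field K] (φ : K →+* ℂ) (F : AddMonoidAlgebra K K) :
    lwEv φ F = ∑ x ∈ F.coeff.support, φ (F.coeff x) * Complex.exp (φ x) := by
  conv_lhs => rw [← AddMonoidAlgebra.sum_coeff_single F]
  rw [Finsupp.sum, map_sum]
  simp only [lwEv_single]

lemma lw_main {K : Type*} [Field K] [NumberField K] [IsGalois ℚ K] (φ : K →+* ℂ)
    (F₀ : AddMonoidAlgebra K K) (hF₀ : F₀ ≠ 0) (hev : lwEv φ F₀ = 0) : False := by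
  classical
  set F : AddMonoidAlgebra K K := ∏ τ : K ≃ₐ[ℚ] K, lwAct τ F₀ with hF
  have hFev : lwEv φ F = 0 := by
    rw [hF, map_prod]
    exact Finset.prod_eq_zero (Finset.mem_univ 1) (by rw [lwAct_one, hev])
  have hF0 : F ≠ 0 := by
    refine Finset.prod_ne_zero_iff.2 fun τ _ h => hF₀ ?_
    have := lwAct_lwAct τ⁻¹ τ F₀
    rw [h, map_zero, inv_mul_cancel, lwAct_one] at this
    exact this.symm
  have hFinv : ∀ σ : K ≃ₐ[ℚ] K, lwAct σ F = F := by
    intro σ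
    rw [hF, map_prod]
    exact Fintype.prod_equiv (Equiv.mulLeft σ) _ _ fun τ => by simp [lwAct_lwAct]
  obtain ⟨y, hy⟩ : ∃ y, F.coeff y ≠ 0 := by
    by_contra! hcon
    exact hF0 (AddMonoidAlgebra.coeff_eq_zero.1 (Finsupp.ext hcon))
  set E : AddMonoidAlgebra K K :=
    ∑ τ : K ≃ₐ[ℚ] K, AddMonoidAlgebra.single (-(τ y)) (τ (F.coeff y)⁻¹) with hE
  have hEinv : ∀ σ : K ≃ₐ[ℚ] K, lwAct σ E = E := by
    intro σ
    rw [hE, map_sum]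
    exact Fintype.sum_equiv (Equiv.mulLeft σ) _ _ fun τ => by simp [lwAct_single]
  set H := F * E with hH
  have hHinv : ∀ σ : K ≃ₐ[ℚ] K, lwAct σ H = H := by
    intro σ; rw [hH, map_mul, hFinv, hEinv]
  have hHc : ∀ (σ : K ≃ₐ[ℚ] K) x, H.coeff (σ x) = σ (H.coeff x) := by
    intro σ x
    rw [← lwAct_coeff, hHinv]
  have hFc : ∀ (σ : K ≃ₐ[ℚ] K) x, F.coeff (σ x) = σ (F.coeff x) := by
    intro σ x
    rw [← lwAct_coeff, hFinv]
  have hH0 : H.coeff 0 = (Fintype.card (K ≃ₐ[ℚ] K) : K) := by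
    rw [hH, hE, Finset.mul_sum, AddMonoidAlgebra.coeff_sum, Finsupp.finsetSum_apply]
    have : ∀ τ : K ≃ₐ[ℚ] K,
        (F * AddMonoidAlgebra.single (-(τ y)) (τ (F.coeff y)⁻¹)).coeff 0 = 1 := by
      intro τ
      rw [AddMonoidAlgebra.coeff_mul_single_eq_coeff_mul (τ y)
        (fun m _ => by rw [add_neg_eq_zero]), hFc, ← map_mul, mul_inv_cancel₀ hy, map_one]
    rw [Finset.sum_congr rfl fun τ _ => this τ]
    simp
  have hH0' : H.coeff 0 ≠ 0 := by
    rw [hH0]; exact_mod_cast Fintype.card_ne_zero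
  have hHev : lwEv φ H = 0 := by rw [hH, map_mul, hFev, zero_mul]
  refine lw_final φ (H.coeff.support.erase 0) H.coeff (by simp) ?_ hHc hH0' ?_
  · intro σ x hx
    simp only [Finset.mem_erase, Finsupp.mem_support_iff] at hx ⊢
    rw [hHc]
    simpa using hx
  · rw [lwEv_eq, ← Finset.add_sum_erase _ _ (Finsupp.mem_support_iff.2 hH0')] at hHev
    simpa using hHev

theorem omega_transcendental (Ω : ℝ) (hΩ : Ω * Real.exp Ω = 1) : Transcendental ℚ Ω := by
  intro halg
  have hC : IsAlgebraic ℚ (Ω : ℂ) := halg.algebraMap (A := ℂ)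
  have hint : IsIntegral ℚ (Ω : ℂ) := hC.isIntegral
  have : FiniteDimensional ℚ (IntermediateField.adjoin ℚ {(Ω : ℂ)}) :=
    IntermediateField.adjoin.finiteDimensional hint
  let K := IntermediateField.normalClosure ℚ (IntermediateField.adjoin ℚ {(Ω : ℂ)}) ℂ
  have : FiniteDimensional ℚ K := inferInstance
  have : NumberField K := ⟨⟩
  have : Normal ℚ K := (Algebra.IsAlgebraic.isNormalClosure_normalClosure
    (fun x => IsAlgClosed.splits _)).normal
  have : IsGalois ℚ K := ⟨⟩
  have hmem : (Ω : ℂ) ∈ K :=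
    IntermediateField.le_normalClosure _ (IntermediateField.mem_adjoin_simple_self ℚ _)
  have hΩ0 : (Ω : ℂ) ≠ 0 := by
    intro h
    have : Ω = 0 := by exact_mod_cast h
    simp [this] at hΩ
  let a : K := ⟨Ω, hmem⟩
  have ha : a ≠ 0 := fun h => hΩ0 (congrArg Subtype.val h)
  refine lw_main (algebraMap K ℂ)
    (AddMonoidAlgebra.single 0 1 - AddMonoidAlgebra.single a a) ?_ ?_
  · intro h
    have := DFunLike.congr_fun (congrArg AddMonoidAlgebra.coeff h) 0
    simp [ha] at this
  · rw [map_sub, lwEv_single, lwEv_single]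
    have h1 : algebraMap K ℂ a = (Ω : ℂ) := rfl
    have h2 : (Ω : ℂ) * Complex.exp Ω = 1 := by exact_mod_cast hΩ
    rw [h1, h2]; simp
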